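/- arXiv:1504.02206 — 4 statements merged into one kernel-verified Lean document; each statement's English description precedes it below -/
import Mathlib

section
/- Let n ≥ 1, let I : Fin n → ℝ be nondecreasing, let w : Fin n → ℝ be nonnegative with A := Σ_j w j > 0, and define f(c) := Σ_j w j · |I j − c|. Suppose j* ∈ Fin n satisfies A − 2·(Σ_{j ≤ j*} w j) ≤ 0 and A − 2·(Σ_{j < j*} w j) > 0, and k ∈ Fin n satisfies A − 2·(Σ_{j ≤ k} w j) < 0 and A − 2·(Σ_{j < k} w j) ≥ 0. Then I(j*) ≤ I(k), and the set of global minimizers of f is exactly the closed interval [I(j*), I(k)]: a real number c satisfies f(c) ≤ f(c') for all c' ∈ ℝ if and only if I(j*) ≤ c ≤ I(k). -/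
theorem aux_split {n : ℕ} (w : Fin n → ℝ) (s : Finset (Fin n)) (t : ℝ) :
    t * (∑ j, w j - 2 * ∑ j ∈ s, w j) = ∑ j, w j * (if j ∈ s then -t else t) := by
  have h : ∑ j ∈ s, w j = ∑ j, if j ∈ s then w j else 0 := by simp
  rw [h, Finset.mul_sum, ← Finset.sum_sub_distrib, Finset.mul_sum]
  refine Finset.sum_congr rfl fun j _ => ?_
  split_ifs <;> ring

theorem aux_left {n : ℕ} (I w : Fin n → ℝ) (hw : ∀ j, 0 ≤ w j) (s : Finset (Fin n)) (c d : ℝ)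
    (hcd : c ≤ d) (hs : ∀ j, j ∉ s → d ≤ I j) :
    (d - c) * (∑ j, w j - 2 * ∑ j ∈ s, w j) ≤ ∑ j, w j * |I j - c| - ∑ j, w j * |I j - d| := by
  rw [aux_split, ← Finset.sum_sub_distrib]
  refine Finset.sum_le_sum fun j _ => ?_
  rw [← mul_sub]
  refine mul_le_mul_of_nonneg_left ?_ (hw j)
  split_ifs with h
  · rcases abs_cases (I j - c) with h1 | h1 <;> rcases abs_cases (I j - d) with h2 | h2 <;> linarith
  · have := hs j h
    rw [abs_of_nonneg (by linarith), abs_of_nonneg (by linarith)]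
    linarith

theorem aux_right {n : ℕ} (I w : Fin n → ℝ) (hw : ∀ j, 0 ≤ w j) (s : Finset (Fin n)) (c d : ℝ)
    (hcd : c ≤ d) (hs : ∀ j, j ∈ s → I j ≤ c) :
    (c - d) * (∑ j, w j - 2 * ∑ j ∈ s, w j) ≤ ∑ j, w j * |I j - d| - ∑ j, w j * |I j - c| := by
  rw [aux_split, ← Finset.sum_sub_distrib]
  refine Finset.sum_le_sum fun j _ => ?_
  rw [← mul_sub]
  refine mul_le_mul_of_nonneg_left ?_ (hw j)
  split_ifs with h
  · have := hs j h
    rw [abs_of_nonpos (by linarith), abs_of_nonpos (by linarith)]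
    linarith
  · rcases abs_cases (I j - c) with h1 | h1 <;> rcases abs_cases (I j - d) with h2 | h2 <;> linarith

theorem stmt_3 (n : ℕ) (hn : 1 ≤ n) (I w : Fin n → ℝ)
    (hI : Monotone I) (hw : ∀ j, 0 ≤ w j)
    (A : ℝ) (hA : A = ∑ j, w j) (hApos : 0 < A)
    (f : ℝ → ℝ) (hf : ∀ c, f c = ∑ j, w j * |I j - c|)
    (jstar : Fin n)
    (hj1 : A - 2 * (∑ j ∈ Finset.Iic jstar, w j) ≤ 0)
    (hj2 : 0 < A - 2 * (∑ j ∈ Finset.Iio jstar, w j))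
    (k : Fin n)
    (hk1 : A - 2 * (∑ j ∈ Finset.Iic k, w j) < 0)
    (hk2 : 0 ≤ A - 2 * (∑ j ∈ Finset.Iio k, w j)) :
    I jstar ≤ I k ∧
    ∀ c : ℝ, (∀ c' : ℝ, f c ≤ f c') ↔ (I jstar ≤ c ∧ c ≤ I k) := by
  subst hA
  have hL : ∀ (m : Fin n) (c d : ℝ), c ≤ d → d ≤ I m →
      (d - c) * (∑ j, w j - 2 * ∑ j ∈ Finset.Iio m, w j) ≤ f c - f d := by
    intro m c d hcd hd
    rw [hf, hf]
    refine aux_left I w hw _ c d hcd fun j hj => hd.trans (hI ?_)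
    simpa using hj
  have hR : ∀ (m : Fin n) (c d : ℝ), c ≤ d → I m ≤ c →
      (c - d) * (∑ j, w j - 2 * ∑ j ∈ Finset.Iic m, w j) ≤ f d - f c := by
    intro m c d hcd hd
    rw [hf, hf]
    refine aux_right I w hw _ c d hcd fun j hj => (hI ?_).trans hd
    simpa using hj
  refine ⟨?_, fun c => ⟨fun h => ⟨?_, ?_⟩, ?_⟩⟩
  · refine hI ?_
    by_contra hlt
    rw [not_le] at hlt
    have : ∑ j ∈ Finset.Iic k, w j ≤ ∑ j ∈ Finset.Iio jstar, w j := by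
      refine Finset.sum_le_sum_of_subset_of_nonneg ?_ fun j _ _ => hw j
      intro j hj
      rw [Finset.mem_Iic] at hj
      rw [Finset.mem_Iio]
      exact lt_of_le_of_lt hj hlt
    linarith
  · by_contra hlt
    rw [not_le] at hlt
    have h1 := hL jstar c (I jstar) hlt.le le_rfl
    have h2 := mul_pos (sub_pos.2 hlt) hj2
    have h3 := h (I jstar)
    linarith
  · by_contra hlt
    rw [not_le] at hlt
    have h1 := hR k (I k) c hlt.le le_rfl
    have h2 := mul_pos_of_neg_of_neg (sub_neg.2 hlt) hk1
    have h3 := h (I k)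
    linarith
  · rintro ⟨ha, hb⟩ c'
    rcases le_total c' c with hc | hc
    · have h1 := hL k c' c hc hb
      have h2 := mul_nonneg (sub_nonneg.2 hc) hk2
      linarith
    · have h1 := hR jstar c c' hc ha
      have h2 := mul_nonneg_of_nonpos_of_nonpos (sub_nonpos.2 hc) hj1
      linarith
end

section
/- Let n ≥ 1, let I : Fin n → ℝ, let w : Fin n → ℝ be nonnegative with A := Σ_j w j > 0, and define f(c) := Σ_j w j · |I j − c|. Then a real number c is a global minimizer of f (i.e., f(c) ≤ f(c') for all c' ∈ ℝ) if and only if Σ_{j : I j < c} w j ≤ A/2 and Σ_{j : I j > c} w j ≤ A/2. -/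
theorem aux_right_s6 (n : ℕ) (I w : Fin n → ℝ) (hw : ∀ j, 0 ≤ w j) (c : ℝ) :
    (∀ c' : ℝ, c ≤ c' → ∑ j, w j * |I j - c| ≤ ∑ j, w j * |I j - c'|) ↔
      (∑ j ∈ Finset.univ.filter (fun j => c < I j), w j) ≤ (∑ j, w j) / 2 := by
  have hid : ∀ d : ℝ, ∑ j, w j * (d * (1 - 2 * (if c < I j then (1 : ℝ) else 0))) =
      d * (∑ j, w j - 2 * ∑ j ∈ Finset.univ.filter (fun j => c < I j), w j) := by
    intro d
    rw [Finset.sum_filter, Finset.mul_sum, ← Finset.sum_sub_distrib, Finset.mul_sum]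
    refine Finset.sum_congr rfl fun j _ => ?_
    split_ifs <;> ring
  constructor
  · intro h
    have hev : ∀ᶠ d in nhdsWithin (0 : ℝ) (Set.Ioi 0), ∀ j, c < I j → d < I j - c := by
      rw [Filter.eventually_all]
      intro j
      by_cases hj : c < I j
      · have : ∀ᶠ d in nhds (0 : ℝ), d < I j - c := eventually_lt_nhds (by linarith)
        filter_upwards [nhdsWithin_le_nhds this] with d hd _ using hd
      · exact Filter.Eventually.of_forall fun d h' => absurd h' hj
    obtain ⟨d, hd, hd0⟩ := (hev.and self_mem_nhdsWithin).exists
    have hd0 : 0 < d := hd0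
    have h1 := h (c + d) (by linarith)
    have h2 : ∑ j, w j * |I j - (c + d)| = ∑ j, w j * |I j - c| +
        ∑ j, w j * (d * (1 - 2 * (if c < I j then (1 : ℝ) else 0))) := by
      rw [← Finset.sum_add_distrib]
      refine Finset.sum_congr rfl fun j _ => ?_
      by_cases hj : c < I j
      · have := hd j hj
        rw [abs_of_pos (by linarith), abs_of_pos (by linarith), if_pos hj]; ring
      · rw [abs_of_nonpos (by linarith), abs_of_nonpos (by linarith), if_neg hj]; ring
    rw [h2, hid] at h1
    have h3 := (mul_nonneg_iff_of_pos_left hd0).1 (le_add_iff_nonneg_right _ |>.1 h1)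
    linarith
  · intro h c' hc
    have h2 : ∑ j, w j * |I j - c| +
        ∑ j, w j * ((c' - c) * (1 - 2 * (if c < I j then (1 : ℝ) else 0))) ≤
        ∑ j, w j * |I j - c'| := by
      rw [← Finset.sum_add_distrib]
      refine Finset.sum_le_sum fun j _ => ?_
      rw [← mul_add]
      refine mul_le_mul_of_nonneg_left ?_ (hw j)
      by_cases hj : c < I j
      · rw [abs_of_pos (by linarith), if_pos hj]
        linarith [le_abs_self (I j - c')]
      · rw [abs_of_nonpos (by linarith), if_neg hj]
        linarith [neg_le_abs (I j - c')]
    rw [hid] at h2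
    have := mul_nonneg (sub_nonneg.2 hc) (by linarith :
      0 ≤ ∑ j, w j - 2 * ∑ j ∈ Finset.univ.filter (fun j => c < I j), w j)
    linarith

theorem stmt_6 (n : ℕ) (hn : 1 ≤ n) (I w : Fin n → ℝ)
    (hw : ∀ j, 0 ≤ w j)
    (A : ℝ) (hA : A = ∑ j, w j) (hApos : 0 < A)
    (f : ℝ → ℝ) (hf : ∀ c, f c = ∑ j, w j * |I j - c|) :
    ∀ c : ℝ, (∀ c' : ℝ, f c ≤ f c') ↔
      ((∑ j ∈ Finset.univ.filter (fun j => I j < c), w j) ≤ A / 2 ∧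
       (∑ j ∈ Finset.univ.filter (fun j => c < I j), w j) ≤ A / 2) := by
  intro c
  have hR := aux_right_s6 n I w hw c
  have hL := aux_right_s6 n (fun j => - I j) w hw (-c)
  have e : ∀ x y : ℝ, |-x - -y| = |x - y| := fun x y => by
    rw [← abs_neg]; congr 1; ring
  simp only [neg_lt_neg_iff, e] at hL
  rw [hA, ← hR, ← hL]
  simp only [hf]
  constructor
  · intro h
    refine ⟨fun c' _ => ?_, fun c' _ => h c'⟩
    have := h (-c')
    rwa [show ∑ j, w j * |I j - -c'| = ∑ j, w j * |-I j - c'| from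
      Finset.sum_congr rfl fun j _ => by rw [← e, neg_neg]] at this
  · rintro ⟨h1, h2⟩ c'
    rcases le_total c c' with h | h
    · exact h2 c' h
    · simpa only [e] using h1 (-c') (neg_le_neg h)
end

section
/- Let H be a real inner product space, let v ∈ H, and let τ > 0. Define the shrinkage S(v, τ) := 0 if ‖v‖ ≤ τ, and S(v, τ) := (1 − τ/‖v‖) • v if ‖v‖ > τ. Then S(v, τ) is the unique global minimizer of the function g(d) := τ‖d‖ + (1/2)‖d − v‖² over d ∈ H: g(S(v, τ)) ≤ g(d) for all d ∈ H, with equality only when d = S(v, τ). -/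
theorem stmt_9 {H : Type*} [NormedAddCommGroup H] [InnerProductSpace ℝ H]
    (v : H) (τ : ℝ) (hτ : 0 < τ)
    (S : H) (hS : S = if ‖v‖ ≤ τ then 0 else (1 - τ / ‖v‖) • v) :
    (∀ d : H, τ * ‖S‖ + (1 / 2) * ‖S - v‖ ^ 2 ≤ τ * ‖d‖ + (1 / 2) * ‖d - v‖ ^ 2) ∧
    (∀ d : H, τ * ‖S‖ + (1 / 2) * ‖S - v‖ ^ 2 = τ * ‖d‖ + (1 / 2) * ‖d - v‖ ^ 2 → d = S) := by
  have hp : ‖v - S‖ ≤ τ ∧ inner ℝ S (v - S) = τ * ‖S‖ := by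
    by_cases h : ‖v‖ ≤ τ
    · rw [if_pos h] at hS
      subst hS
      simpa using h
    · rw [if_neg h] at hS
      push Not at h
      have hv : 0 < ‖v‖ := hτ.trans h
      have e : v - S = (τ / ‖v‖) • v := by rw [hS]; module
      have hc : 0 ≤ 1 - τ / ‖v‖ := by
        rw [sub_nonneg, div_le_one hv]; exact h.le
      constructor
      · rw [e, norm_smul, Real.norm_of_nonneg (by positivity)]
        field_simp
        exact le_refl _
      · rw [e, hS, norm_smul, Real.norm_of_nonneg hc, real_inner_smul_left,
          real_inner_smul_right, real_inner_self_eq_norm_sq]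
        field_simp
  obtain ⟨h1, h2⟩ := hp
  have key : ∀ d : H, τ * ‖S‖ + (1 / 2) * ‖S - v‖ ^ 2 + (1 / 2) * ‖d - S‖ ^ 2
      ≤ τ * ‖d‖ + (1 / 2) * ‖d - v‖ ^ 2 := by
    intro d
    have h3 : inner ℝ d (v - S) ≤ τ * ‖d‖ :=
      (real_inner_le_norm d (v - S)).trans (by nlinarith [norm_nonneg d])
    have e : d - v = (d - S) - (v - S) := by abel
    rw [e, norm_sub_sq_real (d - S) (v - S), inner_sub_left, norm_sub_rev S v]
    linarith
  refine ⟨fun d => ?_, fun d hd => ?_⟩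
  · nlinarith [key d, sq_nonneg ‖d - S‖]
  · have h4 : ‖d - S‖ ^ 2 = 0 := le_antisymm (by linarith [key d]) (sq_nonneg _)
    exact sub_eq_zero.mp (norm_eq_zero.mp (pow_eq_zero_iff two_ne_zero |>.mp h4))
end

section
/- Let m, n ≥ 1, let Ω := Fin m × Fin n, let I : Ω → ℝ, let N ≥ 1, and let λ > 0. For u : Ω → ℝ define the discrete gradient ∇u(i, j) := (D₁u(i, j), D₂u(i, j)) ∈ ℝ², where D₁u(i, j) = u(i+1, j) − u(i, j) if i+1 < m and 0 otherwise, and D₂u(i, j) = u(i, j+1) − u(i, j) if j+1 < n and 0 otherwise; define TV(u) := Σ_{(i,j) ∈ Ω} ‖∇u(i, j)‖ with ‖·‖ the Euclidean norm on ℝ². Define E(U, C) := Σ_{i=1}^N [TV(u_i) + λ Σ_{x ∈ Ω} |I(x) − c_i| · u_i(x)] for U = (u_1, …, u_N), u_i : Ω → ℝ, and C = (c_1, …, c_N) ∈ ℝ^N, and let Δ be the set of U with u_i(x) ≥ 0 for all i, x and Σ_{i=1}^N u_i(x) = 1 for all x ∈ Ω. Then E attains its minimum on Δ × ℝ^N: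 there exists (U*, C*) with U* ∈ Δ and C* ∈ ℝ^N such that E(U*, C*) ≤ E(U, C) for all U ∈ Δ and all C ∈ ℝ^N. -/
/-- Forward difference in the first coordinate, zero across the boundary. -/
def D1 (m n : ℕ) (u : Fin m × Fin n → ℝ) (p : Fin m × Fin n) : ℝ :=
  if h : (p.1 : ℕ) + 1 < m then u (⟨(p.1 : ℕ) + 1, h⟩, p.2) - u p else 0

/-- Forward difference in the second coordinate, zero across the boundary. -/
def D2 (m n : ℕ) (u : Fin m × Fin n → ℝ) (p : Fin m × Fin n) : ℝ :=
  if h : (p.2 : ℕ) + 1 < n then u (p.1, ⟨(p.2 : ℕ) + 1, h⟩) - u p else 0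

/-- Discrete (isotropic) total variation: the sum over all pixels of the Euclidean
norm of the discrete gradient `∇u(i,j) = (D1 u (i,j), D2 u (i,j)) ∈ ℝ²`. -/
noncomputable def TV (m n : ℕ) (u : Fin m × Fin n → ℝ) : ℝ :=
  ∑ p : Fin m × Fin n, Real.sqrt ((D1 m n u p) ^ 2 + (D2 m n u p) ^ 2)

/-- The discrete L1-fidelity fuzzy segmentation energy. -/
noncomputable def E (m n N : ℕ) (I : Fin m × Fin n → ℝ) (lam : ℝ)
    (U : Fin N → Fin m × Fin n → ℝ) (C : Fin N → ℝ) : ℝ :=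
  ∑ i, (TV m n (U i) + lam * ∑ x, |I x - C i| * U i x)

/-- Membership of an `N`-tuple of functions in the fuzzy simplex `Δ`:
nonnegativity and sum-to-one at every pixel. -/
def memDelta (m n N : ℕ) (U : Fin N → Fin m × Fin n → ℝ) : Prop :=
  (∀ i x, 0 ≤ U i x) ∧ ∀ x, ∑ i, U i x = 1

theorem TV_cont (m n : ℕ) : Continuous (TV m n) := by
  unfold TV
  refine continuous_finsetSum _ fun p _ => Real.continuous_sqrt.comp ?_
  refine Continuous.add (Continuous.pow ?_ 2) (Continuous.pow ?_ 2)
  · unfold D1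
    split_ifs <;> fun_prop
  · unfold D2
    split_ifs <;> fun_prop

theorem E_cont (m n N : ℕ) (I : Fin m × Fin n → ℝ) (lam : ℝ) :
    Continuous (fun q : (Fin N → Fin m × Fin n → ℝ) × (Fin N → ℝ) =>
      E m n N I lam q.1 q.2) := by
  unfold E
  refine continuous_finsetSum _ fun i _ => Continuous.add ?_ ?_
  · exact (TV_cont m n).comp (by fun_prop)
  · fun_prop

theorem clamp_le (B a c : ℝ) (h : |a| ≤ B) : |a - max (-B) (min B c)| ≤ |a - c| := by
  obtain ⟨h1, h2⟩ := abs_le.1 h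
  rcases le_total B c with hc | hc
  · rw [min_eq_left hc, max_eq_right (by linarith), abs_le]
    constructor <;> cases abs_cases (a - c) <;> linarith
  · rw [min_eq_right hc]
    rcases le_total (-B) c with hd | hd
    · rw [max_eq_right hd]
    · rw [max_eq_left hd, abs_le]
      constructor <;> cases abs_cases (a - c) <;> linarith

theorem stmt_12 (m n : ℕ) (hm : 1 ≤ m) (hn : 1 ≤ n)
    (I : Fin m × Fin n → ℝ) (N : ℕ) (hN : 1 ≤ N)
    (lam : ℝ) (hlam : 0 < lam) :
    ∃ (Ustar : Fin N → Fin m × Fin n → ℝ) (Cstar : Fin N → ℝ),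
      memDelta m n N Ustar ∧
      ∀ (U : Fin N → Fin m × Fin n → ℝ) (C : Fin N → ℝ),
        memDelta m n N U → E m n N I lam Ustar Cstar ≤ E m n N I lam U C := by
  obtain ⟨B, hB⟩ : ∃ B : ℝ, ∀ x, |I x| ≤ B :=
    ⟨∑ x, |I x|, fun x => Finset.single_le_sum (f := fun x => |I x|)
      (fun i _ => abs_nonneg _) (Finset.mem_univ x)⟩
  have hB0 : 0 ≤ B := (abs_nonneg _).trans (hB (⟨0, hm⟩, ⟨0, hn⟩))
  let S : Set (Fin N → Fin m × Fin n → ℝ) := {U | memDelta m n N U}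
  have hSclosed : IsClosed S := by
    have : S = (⋂ i, ⋂ x, {U | 0 ≤ U i x}) ∩ ⋂ x, {U | ∑ i, U i x = 1} := by
      ext U
      simp [S, memDelta]
    rw [this]
    refine IsClosed.inter ?_ ?_
    · exact isClosed_iInter fun i => isClosed_iInter fun x =>
        isClosed_le continuous_const (by fun_prop)
    · exact isClosed_iInter fun x => isClosed_eq (by fun_prop) continuous_const
  have hS : IsCompact S := by
    refine IsCompact.of_isClosed_subset
      (isCompact_Icc (a := (0 : Fin N → Fin m × Fin n → ℝ)) (b := 1)) hSclosed ?_
    intro U hU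
    refine ⟨fun i x => hU.1 i x, fun i x => ?_⟩
    have := Finset.single_le_sum (f := fun i => U i x)
      (fun i _ => hU.1 i x) (Finset.mem_univ i)
    rw [hU.2 x] at this
    exact this
  have hne : S.Nonempty := by
    refine ⟨fun i _ => if i = ⟨0, hN⟩ then 1 else 0, fun i x => ?_, fun x => ?_⟩
    · dsimp only
      split_ifs <;> norm_num
    · simp
  have hK := hS.prod (isCompact_Icc (a := (fun _ => -B : Fin N → ℝ)) (b := fun _ => B))
  have hKne : (S ×ˢ Set.Icc (fun _ => -B : Fin N → ℝ) (fun _ => B)).Nonempty :=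
    hne.prod ⟨fun _ => 0, fun _ => by simpa using hB0, fun _ => hB0⟩
  obtain ⟨q, hq, hmin⟩ := hK.exists_isMinOn hKne (E_cont m n N I lam).continuousOn
  refine ⟨q.1, q.2, hq.1, fun U C hU => ?_⟩
  have h1 := hmin (a := (U, fun i => max (-B) (min B (C i))))
    ⟨hU, fun i => le_max_left _ _, fun i => max_le (by linarith) (min_le_left _ _)⟩
  refine le_trans h1 ?_
  unfold E
  refine Finset.sum_le_sum fun i _ => ?_
  refine add_le_add le_rfl (mul_le_mul_of_nonneg_left ?_ hlam.le)
  exact Finset.sum_le_sum fun x _ =>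
    mul_le_mul_of_nonneg_right (clamp_le B (I x) (C i) (hB x)) (hU.1 i x)
end
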